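/- Let 0 < α < ∞ and let ω be a radial continuous weight on the unit disc that is either regular or rapidly increasing. Then the radial weight ω*_{α−2}(z) = (1−|z|)^{α−2} ω*(z) is regular, and (ω*_{α−2})*(z) ≍ (1−|z|)^{α} ω*(z) for all |z| ≥ 1/2. -/

import Mathlib

open MeasureTheory Set Filter

noncomputable section

/-- `wInt ω r = ∫_r^1 ω(s) ds`. -/
def wInt (ω : ℝ → ℝ) (r : ℝ) : ℝ := ∫ s in r..1, ω s

/-- A radial weight on the unit disc, identified with a function on `[0,1)`:
positive and integrable. -/
def IsRadialWeight (ω : ℝ → ℝ) : Prop :=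
  (∀ r ∈ Set.Ico (0:ℝ) 1, 0 < ω r) ∧ IntegrableOn ω (Set.Ico (0:ℝ) 1)

/-- A radial continuous weight. -/
def IsRadialContinuousWeight (ω : ℝ → ℝ) : Prop :=
  IsRadialWeight ω ∧ ContinuousOn ω (Set.Ico (0:ℝ) 1)

/-- A regular weight: radial continuous with `ψ_ω(r) ≍ 1 - r`, i.e.
`(1-r)·ω(r) ≍ ∫_r^1 ω(s) ds` on `[0,1)`. -/
def IsRegularWeight (ω : ℝ → ℝ) : Prop :=
  IsRadialContinuousWeight ω ∧ ∃ c C : ℝ, 0 < c ∧ 0 < C ∧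
    ∀ r ∈ Set.Ico (0:ℝ) 1,
      c * ((1 - r) * ω r) ≤ wInt ω r ∧ wInt ω r ≤ C * ((1 - r) * ω r)

/-- A rapidly increasing weight: radial continuous with
`ψ_ω(r)/(1-r) = (∫_r^1 ω)/(ω(r)(1-r)) → ∞` as `r → 1⁻`. -/
def IsRapidlyIncreasing (ω : ℝ → ℝ) : Prop :=
  IsRadialContinuousWeight ω ∧
    Tendsto (fun r => wInt ω r / (ω r * (1 - r))) (nhdsWithin 1 (Set.Iio 1)) atTop

/-- The associated weight as a radial function: `ω*(r) = ∫_r^1 ω(s) log (s/r) s ds`. -/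
def wStarR (ω : ℝ → ℝ) (r : ℝ) : ℝ := ∫ s in r..1, ω s * Real.log (s / r) * s

section Primitive

variable {f : ℝ → ℝ}

lemma IntervalIntegrable.mono_left_unit (hf : IntervalIntegrable f volume 0 1) {r : ℝ}
    (hr : r ∈ Icc (0 : ℝ) 1) : IntervalIntegrable f volume r 1 :=
  hf.mono_set (by rw [uIcc_of_le hr.2, uIcc_of_le zero_le_one]; exact Icc_subset_Icc hr.1 le_rfl)

lemma continuousOn_wInt (hf : IntervalIntegrable f volume 0 1) :
    ContinuousOn (wInt f) (Icc 0 1) := by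
  have h := intervalIntegral.continuousOn_primitive_interval_left (μ := volume)
    (intervalIntegrable_iff' (by finiteness) |>.1 hf)
  rwa [uIcc_of_le zero_le_one] at h

lemma hasDerivAt_wInt (hf : IntervalIntegrable f volume 0 1) (hc : ContinuousOn f (Ioo 0 1))
    {r : ℝ} (hr : r ∈ Ioo (0 : ℝ) 1) : HasDerivAt (wInt f) (-f r) r :=
  intervalIntegral.integral_hasDerivAt_left (hf.mono_left_unit (Ioo_subset_Icc_self hr))
    (hc.stronglyMeasurableAtFilter isOpen_Ioo r hr) (hc.continuousAt (isOpen_Ioo.mem_nhds hr))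

lemma wInt_pos (hf : IntervalIntegrable f volume 0 1) (hpos : ∀ r ∈ Ioo (0 : ℝ) 1, 0 < f r)
    {r : ℝ} (hr : r ∈ Ico (0 : ℝ) 1) : 0 < wInt f r :=
  intervalIntegral.intervalIntegral_pos_of_pos_on (hf.mono_left_unit (Ico_subset_Icc_self hr))
    (fun s hs => hpos s ⟨hr.1.trans_lt hs.1, hs.2⟩) hr.2

lemma wInt_anti (hf : IntervalIntegrable f volume 0 1) (hpos : ∀ r ∈ Ioo (0 : ℝ) 1, 0 < f r)
    {r s : ℝ} (hr : 0 ≤ r) (hrs : r ≤ s) (hs : s ≤ 1) : wInt f s ≤ wInt f r := by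
  have hr1 : IntervalIntegrable f volume r 1 := hf.mono_left_unit ⟨hr, hrs.trans hs⟩
  have hs1 : IntervalIntegrable f volume s 1 := hf.mono_left_unit ⟨hr.trans hrs, hs⟩
  have hadd := intervalIntegral.integral_add_adjacent_intervals (hr1.trans hs1.symm) hs1
  have hnn : ∫ _ in r..s, (0 : ℝ) ≤ ∫ x in r..s, f x :=
    intervalIntegral.integral_mono_on_of_le_Ioo hrs (by simp) (hr1.trans hs1.symm)
      fun x hx => (hpos x ⟨hr.trans_lt hx.1, hx.2.trans_le hs⟩).le
  rw [intervalIntegral.integral_zero] at hnn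
  unfold wInt
  linarith

lemma intervalIntegrable_one_sub_rpow {β : ℝ} (hβ : 0 < β) (a b : ℝ) :
    IntervalIntegrable (fun s : ℝ => (1 - s) ^ (β - 1)) volume a b := by
  have h := (intervalIntegral.intervalIntegrable_rpow' (a := 1 - a) (b := 1 - b)
    (show -1 < β - 1 by linarith)).comp_sub_left 1
  simpa using h

lemma continuous_one_sub_rpow {β : ℝ} (hβ : 0 < β) : Continuous fun s : ℝ => (1 - s) ^ β :=
  (continuous_const.sub continuous_id).rpow_const fun _ => Or.inr hβ.le

lemma intervalIntegrable_one_sub_rpow_mul_wInt (hf : IntervalIntegrable f volume 0 1) {β : ℝ}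
    (hβ : 0 < β) {r : ℝ} (hr : r ∈ Icc (0 : ℝ) 1) :
    IntervalIntegrable (fun s => (1 - s) ^ (β - 1) * wInt f s) volume r 1 := by
  refine (intervalIntegrable_one_sub_rpow hβ r 1).mul_continuousOn ?_
  rw [uIcc_of_le hr.2]
  exact (continuousOn_wInt hf).mono (Icc_subset_Icc hr.1 le_rfl)

/-- Integration by parts for the tail integral against a power of `1 - s`. -/
lemma one_sub_rpow_mul_wInt (hf : IntervalIntegrable f volume 0 1)
    (hc : ContinuousOn f (Ioo 0 1)) {β : ℝ} (hβ : 0 < β) {r : ℝ} (hr : r ∈ Icc (0 : ℝ) 1) :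
    (1 - r) ^ β * wInt f r =
      β * (∫ s in r..1, (1 - s) ^ (β - 1) * wInt f s) + ∫ s in r..1, (1 - s) ^ β * f s := by
  have hi1 := intervalIntegrable_one_sub_rpow_mul_wInt hf hβ hr
  have hi2 : IntervalIntegrable (fun s => (1 - s) ^ β * f s) volume r 1 :=
    (hf.mono_left_unit hr).continuousOn_mul (continuous_one_sub_rpow hβ).continuousOn
  have h := intervalIntegral.integral_eq_sub_of_hasDerivAt_of_le
    (f := fun s => -((1 - s) ^ β * wInt f s))
    (f' := fun s => β * ((1 - s) ^ (β - 1) * wInt f s) + (1 - s) ^ β * f s) hr.2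
    (((continuous_one_sub_rpow hβ).continuousOn.mul
      ((continuousOn_wInt hf).mono (Icc_subset_Icc hr.1 le_rfl))).neg)
    (fun s hs => by
      have hd := ((hasDerivAt_id s).const_sub 1).rpow_const (p := β)
        (Or.inl (sub_pos.2 hs.2).ne')
      have := (hd.mul (hasDerivAt_wInt hf hc ⟨hr.1.trans_lt hs.1, hs.2⟩)).neg
      refine this.congr_deriv ?_
      simp only [id]
      ring)
    ((hi1.const_mul β).add hi2)
  rw [intervalIntegral.integral_add (hi1.const_mul β) hi2,
    intervalIntegral.integral_const_mul] at h
  rw [h]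
  simp [Real.zero_rpow hβ.ne']

lemma mul_integral_one_sub_rpow_mul_wInt_le (hf : IntervalIntegrable f volume 0 1)
    (hc : ContinuousOn f (Ioo 0 1)) (hpos : ∀ r ∈ Ioo (0 : ℝ) 1, 0 < f r) {β : ℝ} (hβ : 0 < β)
    {r : ℝ} (hr : r ∈ Icc (0 : ℝ) 1) :
    β * (∫ s in r..1, (1 - s) ^ (β - 1) * wInt f s) ≤ (1 - r) ^ β * wInt f r := by
  have hi2 : IntervalIntegrable (fun s => (1 - s) ^ β * f s) volume r 1 :=
    (hf.mono_left_unit hr).continuousOn_mul (continuous_one_sub_rpow hβ).continuousOn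
  have hnn : ∫ _ in r..1, (0 : ℝ) ≤ ∫ s in r..1, (1 - s) ^ β * f s :=
    intervalIntegral.integral_mono_on_of_le_Ioo hr.2 (by simp) hi2 fun s hs =>
      mul_nonneg (Real.rpow_nonneg (sub_nonneg.2 hs.2.le) _)
        (hpos s ⟨hr.1.trans_lt hs.1, hs.2⟩).le
  rw [intervalIntegral.integral_zero] at hnn
  linarith [one_sub_rpow_mul_wInt hf hc hβ hr]

lemma one_sub_rpow_mul_wInt_le (hf : IntervalIntegrable f volume 0 1)
    (hc : ContinuousOn f (Ioo 0 1)) {c : ℝ}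
    (hcf : ∀ r ∈ Ico (1 / 2 : ℝ) 1, c * ((1 - r) * f r) ≤ wInt f r) {β : ℝ} (hβ : 0 < β)
    {r : ℝ} (hr : r ∈ Ico (1 / 2 : ℝ) 1) :
    c * ((1 - r) ^ β * wInt f r) ≤
      (c * β + 1) * ∫ s in r..1, (1 - s) ^ (β - 1) * wInt f s := by
  have hr' : r ∈ Icc (0 : ℝ) 1 := ⟨by linarith [hr.1], hr.2.le⟩
  have hi1 := intervalIntegrable_one_sub_rpow_mul_wInt hf hβ hr'
  have hi2 : IntervalIntegrable (fun s => (1 - s) ^ β * f s) volume r 1 :=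
    (hf.mono_left_unit hr').continuousOn_mul (continuous_one_sub_rpow hβ).continuousOn
  have hle : ∫ s in r..1, c * ((1 - s) ^ β * f s) ≤
      ∫ s in r..1, (1 - s) ^ (β - 1) * wInt f s :=
    intervalIntegral.integral_mono_on_of_le_Ioo hr.2.le (hi2.const_mul c) hi1 fun s hs => by
      have h1 : 0 < 1 - s := sub_pos.2 hs.2
      have h2 : (1 - s) ^ β = (1 - s) ^ (β - 1) * (1 - s) := by
        rw [← Real.rpow_add_one h1.ne', sub_add_cancel]
      calc c * ((1 - s) ^ β * f s) = (1 - s) ^ (β - 1) * (c * ((1 - s) * f s)) := by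
            rw [h2]; ring
        _ ≤ _ := by
          gcongr
          exact hcf s ⟨hr.1.trans hs.1.le, hs.2⟩
  rw [intervalIntegral.integral_const_mul] at hle
  rw [one_sub_rpow_mul_wInt hf hc hβ hr']
  linarith

end Primitive

section Star

variable {f : ℝ → ℝ}

lemma intervalIntegrable_wStarR (hf : IntervalIntegrable f volume 0 1) {r : ℝ}
    (hr : r ∈ Ioo (0 : ℝ) 1) :
    IntervalIntegrable (fun s => f s * Real.log (s / r) * s) volume r 1 := by
  simp_rw [mul_assoc]
  refine (hf.mono_left_unit (Ioo_subset_Icc_self hr)).mul_continuousOn ?_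
  rw [uIcc_of_le hr.2.le]
  refine ContinuousOn.mul (ContinuousOn.log (by fun_prop) fun s hs => ?_) (by fun_prop)
  exact (div_pos (hr.1.trans_le hs.1) hr.1).ne'

lemma wStarR_pos (hf : IntervalIntegrable f volume 0 1) (hpos : ∀ r ∈ Ioo (0 : ℝ) 1, 0 < f r)
    {r : ℝ} (hr : r ∈ Ioo (0 : ℝ) 1) : 0 < wStarR f r := by
  refine intervalIntegral.intervalIntegral_pos_of_pos_on (intervalIntegrable_wStarR hf hr)
    (fun s hs => ?_) hr.2
  have hs0 : 0 < s := hr.1.trans hs.1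
  exact mul_pos (mul_pos (hpos s ⟨hs0, hs.2⟩) (Real.log_pos ((one_lt_div hr.1).2 hs.1))) hs0

/-- Splitting the logarithm expresses `ω*` through two tail integrals. -/
lemma wStarR_eq (hf : IntervalIntegrable f volume 0 1) {r : ℝ} (hr : r ∈ Ioo (0 : ℝ) 1) :
    wStarR f r =
      wInt (fun s => f s * (s * Real.log s)) r - Real.log r * wInt (fun s => f s * s) r := by
  have hr' := Ioo_subset_Icc_self hr
  have h1 : IntervalIntegrable (fun s => f s * (s * Real.log s)) volume r 1 :=
    (hf.mono_left_unit hr').mul_continuousOn Real.continuous_mul_log.continuousOn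
  have h2 : IntervalIntegrable (fun s => f s * s) volume r 1 :=
    (hf.mono_left_unit hr').mul_continuousOn continuousOn_id
  unfold wStarR wInt
  rw [← intervalIntegral.integral_const_mul, ← intervalIntegral.integral_sub h1 (h2.const_mul _)]
  refine intervalIntegral.integral_congr fun s hs => ?_
  rw [uIcc_of_le hr.2.le] at hs
  simp only [Real.log_div (hr.1.trans_le hs.1).ne' hr.1.ne']
  ring

lemma continuousOn_wStarR (hf : IntervalIntegrable f volume 0 1) :
    ContinuousOn (wStarR f) (Ioo 0 1) := by
  have h1 := continuousOn_wInt (hf.mul_continuousOn Real.continuous_mul_log.continuousOn)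
  have h2 := continuousOn_wInt (hf.mul_continuousOn continuousOn_id)
  refine ContinuousOn.congr ((h1.mono Ioo_subset_Icc_self).sub
    (ContinuousOn.mul (continuousOn_id.log fun s hs => ?_) (h2.mono Ioo_subset_Icc_self)))
    fun r hr => wStarR_eq hf hr
  exact hs.1.ne'

lemma integral_sub_mul_eq_integral_wInt (hf : IntervalIntegrable f volume 0 1)
    (hc : ContinuousOn f (Ioo 0 1)) {r : ℝ} (hr : r ∈ Icc (0 : ℝ) 1) :
    ∫ s in r..1, (s - r) * f s = ∫ s in r..1, wInt f s := by
  have h := one_sub_rpow_mul_wInt hf hc one_pos hr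
  simp only [Real.rpow_one, sub_self, Real.rpow_zero, one_mul] at h
  have hi := hf.mono_left_unit hr
  have h1 : IntervalIntegrable (fun s => (1 - s) * f s) volume r 1 :=
    hi.continuousOn_mul (by fun_prop)
  have h2 : ∫ s in r..1, (s - r) * f s = ∫ s in r..1, ((1 - r) * f s - (1 - s) * f s) :=
    intervalIntegral.integral_congr fun s _ => by ring
  rw [h2, intervalIntegral.integral_sub (hi.const_mul _) h1, intervalIntegral.integral_const_mul]
  unfold wInt at h ⊢
  linarith

lemma wStarR_le (hf : IntervalIntegrable f volume 0 1) (hc : ContinuousOn f (Ioo 0 1))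
    (hpos : ∀ r ∈ Ioo (0 : ℝ) 1, 0 < f r) {r : ℝ} (hr : r ∈ Ico (1 / 2 : ℝ) 1) :
    wStarR f r ≤ 2 * ((1 - r) * wInt f r) := by
  have hr0 : 0 < r := by linarith [hr.1]
  have hr' : r ∈ Icc (0 : ℝ) 1 := ⟨hr0.le, hr.2.le⟩
  have hle : wStarR f r ≤ ∫ s in r..1, 2 * ((s - r) * f s) :=
    intervalIntegral.integral_mono_on_of_le_Ioo hr.2.le
      (intervalIntegrable_wStarR hf ⟨hr0, hr.2⟩)
      (((hf.mono_left_unit hr').continuousOn_mul (by fun_prop)).const_mul 2) fun s hs => by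
      have hs0 : 0 < s := hr0.trans hs.1
      have hlog : Real.log (s / r) * s ≤ 2 * (s - r) := by
        have h1 := Real.log_le_sub_one_of_pos (div_pos hs0 hr0)
        have h2 : s / r - 1 ≤ 2 * (s - r) := by
          rw [div_sub_one hr0.ne', div_le_iff₀ hr0]
          nlinarith [hs.1, hr.1]
        have h3 : 0 ≤ Real.log (s / r) := Real.log_nonneg ((one_le_div hr0).2 hs.1.le)
        nlinarith [hs.2]
      nlinarith [hpos s ⟨hs0, hs.2⟩]
  have hV := mul_integral_one_sub_rpow_mul_wInt_le hf hc hpos one_pos hr'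
  simp only [Real.rpow_one, sub_self, Real.rpow_zero, one_mul] at hV
  rw [intervalIntegral.integral_const_mul, integral_sub_mul_eq_integral_wInt hf hc hr'] at hle
  linarith

lemma le_wStarR (hf : IntervalIntegrable f volume 0 1) (hc : ContinuousOn f (Ioo 0 1))
    (hpos : ∀ r ∈ Ioo (0 : ℝ) 1, 0 < f r) {c : ℝ} (hc0 : 0 < c)
    (hcf : ∀ r ∈ Ico (1 / 2 : ℝ) 1, c * ((1 - r) * f r) ≤ wInt f r)
    {r : ℝ} (hr : r ∈ Ico (1 / 2 : ℝ) 1) :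
    c / (c + 1) * ((1 - r) * wInt f r) ≤ wStarR f r := by
  have hr0 : 0 < r := by linarith [hr.1]
  have hr' : r ∈ Icc (0 : ℝ) 1 := ⟨hr0.le, hr.2.le⟩
  have hle : ∫ s in r..1, (s - r) * f s ≤ wStarR f r :=
    intervalIntegral.integral_mono_on_of_le_Ioo hr.2.le
      ((hf.mono_left_unit hr').continuousOn_mul (by fun_prop))
      (intervalIntegrable_wStarR hf ⟨hr0, hr.2⟩) fun s hs => by
      have hs0 : 0 < s := hr0.trans hs.1
      have hlog : s - r ≤ Real.log (s / r) * s := by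
        have h1 := Real.one_sub_inv_le_log_of_pos (div_pos hs0 hr0)
        have h2 : (1 - (s / r)⁻¹) * s = s - r := by field_simp
        nlinarith
      nlinarith [hpos s ⟨hs0, hs.2⟩]
  have hV := one_sub_rpow_mul_wInt_le hf hc hcf one_pos hr
  simp only [Real.rpow_one, sub_self, Real.rpow_zero, one_mul, mul_one] at hV
  rw [integral_sub_mul_eq_integral_wInt hf hc hr'] at hle
  rw [div_mul_eq_mul_div, div_le_iff₀ (by linarith)]
  nlinarith

end Star

lemma IsRadialContinuousWeight.intervalIntegrable {ω : ℝ → ℝ} (h : IsRadialContinuousWeight ω) :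
    IntervalIntegrable ω volume 0 1 :=
  (intervalIntegrable_iff_integrableOn_Ico_of_le zero_le_one).2 h.1.2

/-- Both classes of weights satisfy `(1 - r) ω(r) ≲ ∫_r^1 ω` away from the origin. -/
lemma exists_mul_le_wInt {ω : ℝ → ℝ} (hω : IsRegularWeight ω ∨ IsRapidlyIncreasing ω) :
    ∃ c : ℝ, 0 < c ∧ ∀ r ∈ Ico (1 / 2 : ℝ) 1, c * ((1 - r) * ω r) ≤ wInt ω r := by
  rcases hω with ⟨-, c, _, hc, -, h⟩ | ⟨hω, hlim⟩
  · exact ⟨c, hc, fun r hr => (h r ⟨by linarith [hr.1], hr.2⟩).1⟩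
  have hint := hω.intervalIntegrable
  have hpos := hω.1.1
  obtain ⟨ρ, hρ, hρ'⟩ := mem_nhdsLT_iff_exists_Ioo_subset.1 (hlim.eventually_ge_atTop 1)
  rw [mem_Iio] at hρ
  set m := max ρ (1 / 2) with hm
  have hm1 : m < 1 := max_lt hρ (by norm_num)
  have hm2 : 1 / 2 ≤ m := le_max_right _ _
  have hsub : Icc (1 / 2 : ℝ) m ⊆ Ico 0 1 :=
    fun r hr => ⟨by linarith [hr.1], hr.2.trans_lt hm1⟩
  have hden : ∀ r ∈ Ico (0 : ℝ) 1, 0 < (1 - r) * ω r :=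
    fun r hr => mul_pos (sub_pos.2 hr.2) (hpos r hr)
  have hcont : ContinuousOn (fun r => wInt ω r / ((1 - r) * ω r)) (Icc (1 / 2) m) :=
    ((continuousOn_wInt hint).mono (hsub.trans Ico_subset_Icc_self)).div
      (ContinuousOn.mul (by fun_prop) (hω.2.mono hsub)) fun r hr => (hden r (hsub hr)).ne'
  obtain ⟨x, hx, hmin⟩ := isCompact_Icc.exists_isMinOn (nonempty_Icc.2 hm2) hcont
  have hq : 0 < wInt ω x / ((1 - x) * ω x) :=
    div_pos (wInt_pos hint (fun r hr => hpos r (Ioo_subset_Ico_self hr)) (hsub hx))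
      (hden x (hsub hx))
  refine ⟨min 1 (wInt ω x / ((1 - x) * ω x)), lt_min one_pos hq, fun r hr => ?_⟩
  have hr' : r ∈ Ico (0 : ℝ) 1 := ⟨by linarith [hr.1], hr.2⟩
  rw [← le_div_iff₀ (hden r hr')]
  rcases le_or_gt r m with hrm | hrm
  · exact (min_le_right _ _).trans (hmin ⟨hr.1, hrm⟩)
  · refine (min_le_left _ _).trans ?_
    rw [mul_comm]
    exact hρ' ⟨(le_max_left _ _).trans_lt hrm, hr.2⟩

section Weighted

variable {f : ℝ → ℝ}

lemma intervalIntegrable_one_sub_rpow_mul_wStarR (hf : IntervalIntegrable f volume 0 1)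
    (hc : ContinuousOn f (Ioo 0 1)) (hpos : ∀ r ∈ Ioo (0 : ℝ) 1, 0 < f r) {α : ℝ} (hα : 0 < α) :
    IntervalIntegrable (fun r => (1 - r) ^ (α - 2) * wStarR f r) volume 0 1 := by
  have hcont : ContinuousOn (fun r => (1 - r) ^ (α - 2) * wStarR f r) (Ioo 0 1) :=
    ContinuousOn.mul (ContinuousOn.rpow_const (by fun_prop) fun s hs =>
      Or.inl (sub_pos.2 hs.2).ne') (continuousOn_wStarR hf)
  refine IntervalIntegrable.trans (b := 1 / 2) ?_ ?_
  · have h1 := continuousOn_wInt (hf.mul_continuousOn Real.continuous_mul_log.continuousOn)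
    have h2 := continuousOn_wInt (hf.mul_continuousOn continuousOn_id)
    have hsub : uIcc (0 : ℝ) (1 / 2) ⊆ Icc 0 1 := by
      rw [uIcc_of_le (by norm_num)]; exact Icc_subset_Icc le_rfl (by norm_num)
    have h3 : IntervalIntegrable (fun r => (1 - r) ^ (α - 2) *
        (wInt (fun s => f s * (s * Real.log s)) r -
          Real.log r * wInt (fun s => f s * s) r)) volume 0 (1 / 2) := by
      refine IntervalIntegrable.continuousOn_mul ((h1.mono hsub).intervalIntegrable.sub
        (intervalIntegral.intervalIntegrable_log'.mul_continuousOn (h2.mono hsub))) ?_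
      refine ContinuousOn.rpow_const (by fun_prop) fun s hs => Or.inl ?_
      rw [uIcc_of_le (by norm_num)] at hs
      linarith [hs.2]
    refine h3.congr fun r hr => ?_
    rw [uIoc_of_le (by norm_num)] at hr
    simp only [wStarR_eq hf ⟨hr.1, by linarith [hr.2]⟩]
  · have hbd := (intervalIntegrable_one_sub_rpow_mul_wInt hf hα
      (r := 1 / 2) (by norm_num)).const_mul 2
    rw [intervalIntegrable_iff_integrableOn_Ioo_of_le (by norm_num)] at hbd ⊢
    refine Integrable.mono' hbd
      ((hcont.mono (Ioo_subset_Ioo (by norm_num) le_rfl)).aestronglyMeasurable measurableSet_Ioo)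
      ((ae_restrict_iff' measurableSet_Ioo).2 (ae_of_all _ fun r hr => ?_))
    have hr0 : r ∈ Ioo (0 : ℝ) 1 := ⟨by linarith [hr.1], hr.2⟩
    have h1 : 0 < 1 - r := sub_pos.2 hr.2
    have h2 : (1 - r) ^ (α - 1) = (1 - r) ^ (α - 2) * (1 - r) := by
      rw [← Real.rpow_add_one h1.ne']; ring_nf
    rw [Real.norm_of_nonneg (mul_nonneg (Real.rpow_nonneg h1.le _) (wStarR_pos hf hpos hr0).le)]
    calc _ ≤ (1 - r) ^ (α - 2) * (2 * ((1 - r) * wInt f r)) := by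
          gcongr
          exact wStarR_le hf hc hpos (Ioo_subset_Ico_self hr)
      _ = _ := by rw [h2]; ring

end Weighted

theorem stmt5 (α : ℝ) (hα : 0 < α) (ω : ℝ → ℝ)
    (hω : IsRegularWeight ω ∨ IsRapidlyIncreasing ω) :
    -- `ω*_{α-2}(r) = (1-r)^{α-2} ω*(r)` is a regular weight (regularity being a
    -- condition near the boundary; `ω*` itself is only defined for `r > 0`):
    (∀ r ∈ Set.Ioo (0:ℝ) 1, 0 < (1 - r) ^ (α - 2) * wStarR ω r) ∧
    ContinuousOn (fun r => (1 - r) ^ (α - 2) * wStarR ω r) (Set.Ioo (0:ℝ) 1) ∧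
    IntegrableOn (fun r => (1 - r) ^ (α - 2) * wStarR ω r) (Set.Ioo (0:ℝ) 1) ∧
    (∃ c C : ℝ, 0 < c ∧ 0 < C ∧ ∀ r ∈ Set.Ico (1/2 : ℝ) 1,
      c * ((1 - r) * ((1 - r) ^ (α - 2) * wStarR ω r)) ≤
          wInt (fun s => (1 - s) ^ (α - 2) * wStarR ω s) r ∧
        wInt (fun s => (1 - s) ^ (α - 2) * wStarR ω s) r ≤
          C * ((1 - r) * ((1 - r) ^ (α - 2) * wStarR ω r))) ∧
    -- `(ω*_{α-2})*(r) ≍ (1-r)^α ω*(r)` for `1/2 ≤ r < 1`: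
    (∃ c C : ℝ, 0 < c ∧ 0 < C ∧ ∀ r ∈ Set.Ico (1/2 : ℝ) 1,
      c * ((1 - r) ^ α * wStarR ω r) ≤
          wStarR (fun s => (1 - s) ^ (α - 2) * wStarR ω s) r ∧
        wStarR (fun s => (1 - s) ^ (α - 2) * wStarR ω s) r ≤
          C * ((1 - r) ^ α * wStarR ω r)) := by

  obtain ⟨hint, hcont, hpos⟩ : IntervalIntegrable ω volume 0 1 ∧ ContinuousOn ω (Ioo 0 1) ∧
      ∀ r ∈ Ioo (0 : ℝ) 1, 0 < ω r := by
    have hrad : IsRadialContinuousWeight ω := hω.elim (fun h => h.1) fun h => h.1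
    exact ⟨hrad.intervalIntegrable, hrad.2.mono Ioo_subset_Ico_self,
      fun r hr => hrad.1.1 r (Ioo_subset_Ico_self hr)⟩
  obtain ⟨c, hc0, hc⟩ := exists_mul_le_wInt hω
  set F : ℝ → ℝ := fun r => (1 - r) ^ (α - 2) * wStarR ω r with hF
  have hFpos : ∀ r ∈ Ioo (0 : ℝ) 1, 0 < F r := fun r hr =>
    mul_pos (Real.rpow_pos_of_pos (sub_pos.2 hr.2) _) (wStarR_pos hint hpos hr)
  have hFcont : ContinuousOn F (Ioo 0 1) :=
    ContinuousOn.mul (ContinuousOn.rpow_const (by fun_prop) fun s hs =>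
      Or.inl (sub_pos.2 hs.2).ne') (continuousOn_wStarR hint)
  have hFint : IntervalIntegrable F volume 0 1 :=
    intervalIntegrable_one_sub_rpow_mul_wStarR hint hcont hpos hα
  have hpow : ∀ r < (1 : ℝ), (1 - r) ^ (α - 1) = (1 - r) ^ (α - 2) * (1 - r) ∧
      (1 - r) ^ α = (1 - r) ^ (α - 2) * (1 - r) * (1 - r) := fun r hr => by
    have h : (1 - r) ≠ 0 := (sub_pos.2 hr).ne'
    rw [← Real.rpow_add_one h, ← Real.rpow_add_one h]
    constructor <;> ring_nf
  set k := c / (c + 1) with hk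
  have hk0 : 0 < k := by positivity
  have hFle : ∀ r ∈ Ico (1 / 2 : ℝ) 1, F r ≤ 2 * ((1 - r) ^ (α - 1) * wInt ω r) := fun r hr => by
    have := mul_le_mul_of_nonneg_left (wStarR_le hint hcont hpos hr)
      (Real.rpow_nonneg (sub_pos.2 hr.2).le (α - 2))
    rw [(hpow r hr.2).1]
    linarith
  have hleF : ∀ r ∈ Ico (1 / 2 : ℝ) 1, k * ((1 - r) ^ (α - 1) * wInt ω r) ≤ F r := fun r hr => by
    have := mul_le_mul_of_nonneg_left (le_wStarR hint hcont hpos hc0 hc hr)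
      (Real.rpow_nonneg (sub_pos.2 hr.2).le (α - 2))
    rw [(hpow r hr.2).1]
    linarith
  have hreg : ∃ c C : ℝ, 0 < c ∧ 0 < C ∧ ∀ r ∈ Ico (1 / 2 : ℝ) 1,
      c * ((1 - r) * F r) ≤ wInt F r ∧ wInt F r ≤ C * ((1 - r) * F r) := by
    refine ⟨k * c / (2 * (c * α + 1)), 2 / (α * k), by positivity, by positivity,
      fun r hr => ?_⟩
    have hr' : r ∈ Icc (0 : ℝ) 1 := ⟨by linarith [hr.1], hr.2.le⟩
    have hi := intervalIntegrable_one_sub_rpow_mul_wInt hint hα hr'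
    have hFr := hFint.mono_left_unit hr'
    set J := ∫ s in r..1, (1 - s) ^ (α - 1) * wInt ω s with hJ
    have hlow : k * J ≤ wInt F r := by
      rw [hJ, ← intervalIntegral.integral_const_mul]
      exact intervalIntegral.integral_mono_on_of_le_Ioo hr.2.le (hi.const_mul k) hFr
        fun s hs => hleF s ⟨hr.1.trans hs.1.le, hs.2⟩
    have hup : wInt F r ≤ 2 * J := by
      rw [hJ, ← intervalIntegral.integral_const_mul]
      exact intervalIntegral.integral_mono_on_of_le_Ioo hr.2.le hFr (hi.const_mul 2)
        fun s hs => hFle s ⟨hr.1.trans hs.1.le, hs.2⟩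
    have hJ1 : c * ((1 - r) ^ α * wInt ω r) ≤ (c * α + 1) * J :=
      one_sub_rpow_mul_wInt_le hint hcont hc hα hr
    have hJ2 : α * J ≤ (1 - r) ^ α * wInt ω r :=
      mul_integral_one_sub_rpow_mul_wInt_le hint hcont hpos hα hr'
    have h1 : 0 ≤ 1 - r := (sub_pos.2 hr.2).le
    have hG : (1 - r) * ((1 - r) ^ (α - 1) * wInt ω r) = (1 - r) ^ α * wInt ω r := by
      rw [(hpow r hr.2).1, (hpow r hr.2).2]; ring
    have hF1 : (1 - r) * F r ≤ 2 * ((1 - r) ^ α * wInt ω r) := by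
      rw [← hG, mul_left_comm 2]
      exact mul_le_mul_of_nonneg_left (hFle r hr) h1
    have hF2 : k * ((1 - r) ^ α * wInt ω r) ≤ (1 - r) * F r := by
      rw [← hG, mul_left_comm]
      exact mul_le_mul_of_nonneg_left (hleF r hr) h1
    constructor
    · rw [div_mul_eq_mul_div, div_le_iff₀ (by positivity)]
      calc k * c * ((1 - r) * F r) ≤ k * c * (2 * ((1 - r) ^ α * wInt ω r)) := by gcongr
        _ = 2 * k * (c * ((1 - r) ^ α * wInt ω r)) := by ring
        _ ≤ 2 * k * ((c * α + 1) * J) := by gcongr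
        _ = k * J * (2 * (c * α + 1)) := by ring
        _ ≤ _ := by gcongr
    · rw [div_mul_eq_mul_div, le_div_iff₀ (by positivity)]
      calc wInt F r * (α * k) ≤ 2 * J * (α * k) := by gcongr
        _ = 2 * k * (α * J) := by ring
        _ ≤ 2 * k * ((1 - r) ^ α * wInt ω r) := by gcongr
        _ = 2 * (k * ((1 - r) ^ α * wInt ω r)) := by ring
        _ ≤ _ := by gcongr
  refine ⟨hFpos, hFcont, (intervalIntegrable_iff_integrableOn_Ioo_of_le zero_le_one).1 hFint,
    hreg, ?_⟩
  obtain ⟨a, A, ha, hA, haA⟩ := hreg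
  refine ⟨a / (a + 1) * a, 2 * A, by positivity, by positivity, fun r hr => ?_⟩
  have h1 : 0 ≤ 1 - r := (sub_pos.2 hr.2).le
  have hG : (1 - r) ^ α * wStarR ω r = (1 - r) * ((1 - r) * F r) := by
    rw [(hpow r hr.2).2]; ring
  obtain ⟨hlow, hup⟩ := haA r hr
  rw [hG]
  constructor
  · calc a / (a + 1) * a * ((1 - r) * ((1 - r) * F r))
        = a / (a + 1) * ((1 - r) * (a * ((1 - r) * F r))) := by ring
      _ ≤ a / (a + 1) * ((1 - r) * wInt F r) := by gcongr
      _ ≤ _ := le_wStarR hFint hFcont hFpos ha (fun s hs => (haA s hs).1) hr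
  · calc wStarR F r ≤ 2 * ((1 - r) * wInt F r) := wStarR_le hFint hFcont hFpos hr
      _ ≤ 2 * ((1 - r) * (A * ((1 - r) * F r))) := by gcongr
      _ = _ := by ring
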